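/- There exist functions $\Psi, h \in C^\infty([1,\infty))$ with $0 < h < \Psi$, $\Psi' > 0$ and $h' > 0$ on $[1,\infty)$, such that $\int_1^\infty \frac{1}{\Psi'} = \infty$ while $\int_1^\infty \frac{1}{h'} < \infty$. In particular, one may take $h(x) = x^3$ and a smooth increasing $\Psi$ with $\Psi(x) = 7nx + n^3$ on each interval $[n, n+1/2]$ for integers $n \geq 1$. -/

import Mathlib

open MeasureTheory Set

noncomputable def psiF : ℕ → ℝ → ℝ
  | 0 => fun x => 7 * x + 1
  | (N + 1) => fun x => psiF N x +
      Real.smoothTransition (2 * (x - N) - 3) * (7 * x + 3 * ((N:ℝ) + 1) ^ 2 + 3 * ((N:ℝ) + 1) + 1)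

lemma psiF_succ (N : ℕ) (x : ℝ) : psiF (N + 1) x = psiF N x +
      Real.smoothTransition (2 * (x - N) - 3) *
        (7 * x + 3 * ((N:ℝ) + 1) ^ 2 + 3 * ((N:ℝ) + 1) + 1) := rfl

lemma psiF_smooth (N : ℕ) : ContDiff ℝ (⊤ : ℕ∞) (psiF N) := by
  induction N with
  | zero =>
    show ContDiff ℝ _ (fun x : ℝ => 7 * x + 1)
    fun_prop
  | succ N ih =>
    have h1 : ContDiff ℝ (⊤ : ℕ∞) (fun x : ℝ => Real.smoothTransition (2 * (x - N) - 3)) :=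
      Real.smoothTransition.contDiff.comp (by fun_prop)
    exact ih.add (h1.mul (by fun_prop))

lemma psiF_stable (N j : ℕ) (x : ℝ) (hx : x ≤ N + 3 / 2) : psiF (N + j) x = psiF N x := by
  induction j with
  | zero => rfl
  | succ j ih =>
    rw [← add_assoc, psiF_succ, Real.smoothTransition.zero_of_nonpos, ih]
    · ring
    · push_cast
      have : (0:ℝ) ≤ j := Nat.cast_nonneg j
      linarith

lemma psiF_val (N : ℕ) (x : ℝ) (hx : (N:ℝ) + 1 ≤ x) :
    psiF N x = 7 * (N + 1) * x + ((N:ℝ) + 1) ^ 3 := by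
  induction N with
  | zero => simp [psiF]
  | succ N ih =>
    push_cast at hx ⊢
    rw [psiF_succ, Real.smoothTransition.one_of_one_le (by linarith), ih (by linarith)]
    ring

lemma psiF_deriv_pos (N : ℕ) (x : ℝ) (hx : 0 ≤ x) : 0 < deriv (psiF N) x := by
  induction N with
  | zero =>
    have : HasDerivAt (psiF 0) (7 * 1) x := by
      exact ((hasDerivAt_id x).const_mul 7).add_const 1
    rw [this.deriv]; norm_num
  | succ N ih =>
    have h0 : HasDerivAt (psiF N) (deriv (psiF N) x) x :=
      (((psiF_smooth N).differentiable (by simp)) x).hasDerivAt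
    have hs : ContDiff ℝ (⊤ : ℕ∞) (fun x : ℝ => Real.smoothTransition (2 * (x - N) - 3)) :=
      Real.smoothTransition.contDiff.comp (by fun_prop)
    have hm : Monotone (fun x : ℝ => Real.smoothTransition (2 * (x - N) - 3)) := by
      intro a b hab
      apply Real.smoothTransition.monotone
      linarith
    have h1 := ((hs.differentiable (by simp)) x).hasDerivAt
    have hn : 0 ≤ deriv (fun x : ℝ => Real.smoothTransition (2 * (x - N) - 3)) x :=
      hm.deriv_nonneg
    have h2 : HasDerivAt (fun x : ℝ => 7 * x + 3 * ((N:ℝ) + 1) ^ 2 + 3 * ((N:ℝ) + 1) + 1)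
        (7 * 1) x :=
      ((((hasDerivAt_id x).const_mul 7).add_const _).add_const _).add_const _
    have h3 : HasDerivAt (psiF (N + 1)) _ x := h0.add (h1.mul h2)
    rw [h3.deriv]
    have := Real.smoothTransition.nonneg (2 * (x - N) - 3)
    have hp : 0 ≤ 7 * x + 3 * ((N:ℝ) + 1) ^ 2 + 3 * ((N:ℝ) + 1) + 1 := by positivity
    have := mul_nonneg hn hp
    linarith

noncomputable def bigPsi (x : ℝ) : ℝ := psiF ⌊x⌋₊ x

lemma bigPsi_eq (N : ℕ) (x : ℝ) (hx : x ≤ N + 3 / 2) : bigPsi x = psiF N x := by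
  unfold bigPsi
  have h := (Nat.lt_floor_add_one x).le
  rcases le_total N ⌊x⌋₊ with h1 | h1
  · obtain ⟨j, hj⟩ := Nat.exists_eq_add_of_le h1
    rw [hj, psiF_stable _ _ _ hx]
  · obtain ⟨j, hj⟩ := Nat.exists_eq_add_of_le h1
    rw [hj, psiF_stable _ _ _ (by linarith)]

lemma bigPsi_ev (x : ℝ) : bigPsi =ᶠ[nhds x] psiF ⌊x⌋₊ := by
  filter_upwards [Iio_mem_nhds (Nat.lt_floor_add_one x)] with y hy
  exact bigPsi_eq _ _ (by simp only [mem_Iio] at hy; linarith)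

lemma bigPsi_smooth : ContDiff ℝ (⊤ : ℕ∞) bigPsi :=
  contDiff_iff_contDiffAt.2 fun x =>
    ((psiF_smooth ⌊x⌋₊).contDiffAt).congr_of_eventuallyEq (bigPsi_ev x)

lemma bigPsi_line (m : ℕ) (x : ℝ) (hx : x ∈ Icc ((m:ℝ) + 1) (m + 3 / 2)) :
    bigPsi x = 7 * (m + 1) * x + ((m:ℝ) + 1) ^ 3 := by
  rw [bigPsi_eq m x hx.2, psiF_val m x hx.1]

lemma bigPsi_gt (x : ℝ) (hx : 1 ≤ x) : x ^ 3 < bigPsi x := by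
  have hf : 1 ≤ ⌊x⌋₊ := Nat.le_floor (by simpa using hx)
  obtain ⟨m, hm⟩ := Nat.exists_eq_add_of_le' hf
  have h1 := Nat.floor_le (by linarith : 0 ≤ x)
  have h2 := Nat.lt_floor_add_one x
  unfold bigPsi
  rw [hm] at h1 h2 ⊢
  push_cast at h1 h2
  rw [psiF_succ, psiF_val m x h1]
  have hp : 0 ≤ 7 * x + 3 * ((m:ℝ) + 1) ^ 2 + 3 * ((m:ℝ) + 1) + 1 := by positivity
  have := mul_nonneg (Real.smoothTransition.nonneg (2 * (x - m) - 3)) hp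
  have hN : (1:ℝ) ≤ m + 1 := by have : (0:ℝ) ≤ m := Nat.cast_nonneg m
                                linarith
  generalize (m:ℝ) + 1 = n at *
  have e : x ^ 3 - n ^ 3 = (x - n) * (x ^ 2 + x * n + n ^ 2) := by ring
  have e1 : (x - n) * (x ^ 2 + x * n + n ^ 2) ≤ 1 * (x ^ 2 + x * n + n ^ 2) := by
    apply mul_le_mul_of_nonneg_right (by linarith); positivity
  nlinarith [mul_le_mul_of_nonneg_left h2.le (by linarith : 0 ≤ x),
    mul_le_mul_of_nonneg_left h1 (by linarith : 0 ≤ n),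
    mul_le_mul_of_nonneg_left hN (by linarith : 0 ≤ x), mul_pos (by linarith : 0 < x) (by linarith : 0 < n)]

lemma bigPsi_deriv_line (m : ℕ) (x : ℝ) (hx : x ∈ Ioo ((m:ℝ) + 1) (m + 3 / 2)) :
    deriv bigPsi x = 7 * (m + 1) := by
  have h : bigPsi =ᶠ[nhds x] fun x => 7 * ((m:ℝ) + 1) * x + ((m:ℝ) + 1) ^ 3 := by
    filter_upwards [Ioo_mem_nhds hx.1 hx.2] with y hy
    exact bigPsi_line m y ⟨hy.1.le, hy.2.le⟩
  rw [h.deriv_eq]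
  have := (((hasDerivAt_id x).const_mul (7 * ((m:ℝ) + 1))).add_const (((m:ℝ) + 1) ^ 3)).deriv
  simpa using this

lemma bigPsi_lint : ∫⁻ x in Ioi (1:ℝ), ENNReal.ofReal (1 / deriv bigPsi x) = ⊤ := by
  have hsub : (⋃ m : ℕ, Ioo ((m:ℝ) + 1) (m + 3 / 2)) ⊆ Ioi 1 := by
    intro x hx
    obtain ⟨m, hm⟩ := mem_iUnion.1 hx
    have : (0:ℝ) ≤ m := Nat.cast_nonneg m
    have := hm.1
    simp only [mem_Ioi]; linarith
  have hdis : Pairwise (Function.onFun Disjoint fun m : ℕ => Ioo ((m:ℝ) + 1) (m + 3 / 2)) := by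
    intro i j hij
    refine Set.disjoint_left.2 fun x hi hj => hij ?_
    have a1 : (i:ℝ) < j + 1 := by linarith [hi.1, hj.2]
    have a2 : (j:ℝ) < i + 1 := by linarith [hj.1, hi.2]
    have b1 : i < j + 1 := by exact_mod_cast a1
    have b2 : j < i + 1 := by exact_mod_cast a2
    omega
  rw [eq_top_iff]
  refine le_trans ?_ (lintegral_mono_set hsub)
  rw [lintegral_iUnion (fun i => measurableSet_Ioo) hdis]
  have hval : ∀ m : ℕ, ∫⁻ x in Ioo ((m:ℝ) + 1) (m + 3 / 2), ENNReal.ofReal (1 / deriv bigPsi x)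
      = ENNReal.ofReal (1 / 14 * (1 / ((m + 1 : ℕ) : ℝ))) := by
    intro m
    rw [setLIntegral_congr_fun (g := fun _ => ENNReal.ofReal (1 / (7 * ((m:ℝ) + 1))))
      measurableSet_Ioo (fun x hx => by simp only [bigPsi_deriv_line m x hx])]
    rw [setLIntegral_const, Real.volume_Ioo, ← ENNReal.ofReal_mul (by positivity)]
    congr 1
    push_cast
    field_simp
    ring
  simp_rw [hval]
  rw [top_le_iff]
  by_contra hne
  have hs := ENNReal.summable_toReal hne
  have hs2 : Summable fun m : ℕ => 1 / 14 * (1 / ((m + 1 : ℕ) : ℝ)) := by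
    refine hs.congr fun m => ?_
    rw [ENNReal.toReal_ofReal (by positivity)]
  rw [summable_mul_left_iff (by norm_num)] at hs2
  exact Real.not_summable_one_div_natCast
    ((summable_nat_add_iff (f := fun n : ℕ => 1 / (n:ℝ)) 1).1 hs2)

lemma cube_lint : ∫⁻ x in Ioi (1:ℝ), ENNReal.ofReal (1 / (3 * x ^ 2)) < ⊤ := by
  have h := (integrableOn_Ioi_rpow_of_lt (by norm_num : (-2:ℝ) < -1) one_pos).const_mul (1 / 3)
  have h2 : IntegrableOn (fun x : ℝ => 1 / (3 * x ^ 2)) (Ioi 1) := by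
    refine IntegrableOn.congr_fun h (fun x hx => ?_) measurableSet_Ioi
    have hx0 : (0:ℝ) < x := lt_trans one_pos hx
    rw [Real.rpow_neg hx0.le, Real.rpow_two]
    field_simp
  exact h2.lintegral_lt_top

/-- Remark 3 of the paper: there exist `Ψ, h ∈ C^∞([1,∞))` with `0 < h < Ψ`,
`Ψ' > 0`, `h' > 0` on `[1,∞)`, `∫_1^∞ 1/Ψ' = ∞` while `∫_1^∞ 1/h' < ∞`.
One may take `h x = x³` and a smooth increasing `Ψ` with `Ψ x = 7 n x + n³`
on each `[n, n + 1/2]`, `n ≥ 1`. -/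
theorem stmt_8 : ∃ Ψ h Ψ' h' : ℝ → ℝ,
    ContDiffOn ℝ (⊤ : ℕ∞) Ψ (Ici 1) ∧ ContDiffOn ℝ (⊤ : ℕ∞) h (Ici 1) ∧
    (∀ x ∈ Ici (1:ℝ), HasDerivWithinAt Ψ (Ψ' x) (Ici 1) x) ∧
    (∀ x ∈ Ici (1:ℝ), HasDerivWithinAt h (h' x) (Ici 1) x) ∧
    (∀ x ∈ Ici (1:ℝ), 0 < h x ∧ h x < Ψ x ∧ 0 < Ψ' x ∧ 0 < h' x) ∧
    (∫⁻ x in Ioi (1:ℝ), ENNReal.ofReal (1 / Ψ' x) = ⊤) ∧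
    (∫⁻ x in Ioi (1:ℝ), ENNReal.ofReal (1 / h' x) < ⊤) ∧
    (∀ x ∈ Ici (1:ℝ), h x = x ^ 3) ∧
    (∀ n : ℕ, 1 ≤ n → ∀ x ∈ Icc (n:ℝ) (n + 1/2), Ψ x = 7 * n * x + n ^ 3) := by
  refine ⟨bigPsi, fun x => x ^ 3, deriv bigPsi, fun x => 3 * x ^ 2, bigPsi_smooth.contDiffOn,
    by fun_prop, fun x _ => ?_, fun x _ => ?_, fun x hx => ?_, bigPsi_lint, cube_lint,
    fun _ _ => rfl, ?_⟩
  · exact ((bigPsi_smooth.differentiable (by simp)) x).hasDerivAt.hasDerivWithinAt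
  · simpa using (hasDerivAt_pow 3 x).hasDerivWithinAt
  · have hx1 : (1:ℝ) ≤ x := hx
    have hx0 : (0:ℝ) < x := by linarith
    refine ⟨by positivity, bigPsi_gt x hx1, ?_, by positivity⟩
    rw [(bigPsi_ev x).deriv_eq]
    exact psiF_deriv_pos _ _ hx0.le
  · intro n hn x hx
    obtain ⟨m, rfl⟩ := Nat.exists_eq_add_of_le' hn
    push_cast at hx ⊢
    exact bigPsi_line m x ⟨hx.1, by linarith [hx.2]⟩
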